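/- Suppose Assumptions A1 and A2 hold, 5q + 2s − 1 < 0, 4q + s + p − 2 < 0, and 2q + s ≤ p < (1−q)/2. Let (x,λ) be a global solution of the dynamical system, let (x_t,λ_t) be the unique saddle point of L_t with t ↦ (x_t,λ_t) continuously differentiable, and let (x*,λ*) be the projection of the origin onto Ω. Then, as t → +∞: L(x(t),λ*) − L(x*,λ*) = O(√(m(t)) t^{(q−1)/2} + t^{−p}), |f(x(t)) − f(x*)| = O(√(m(t)) t^{(q−1)/2} + t^{−p}), ‖Ax(t) − b‖ = O(√(m(t)) t^{(q−1)/2} + t^{−p}), and ‖(x(t)−x_t, λ(t)−λ_t)‖² = O(m(t) t^{q−1}). -/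

import Mathlib

open Real Filter Asymptotics
open scoped RealInnerProductSpace Topology

theorem ConvexOn.add_inner_le_of_hasGradientAt {X : Type*} [NormedAddCommGroup X]
    [InnerProductSpace ℝ X] [CompleteSpace X] {f : X → ℝ} (hconv : ConvexOn ℝ Set.univ f)
    {g u : X} (hf : HasGradientAt f g u) (y : X) : f u + ⟪g, y - u⟫ ≤ f y := by
  have hline : ConvexOn ℝ Set.univ (f ∘ (AffineMap.lineMap u y : ℝ →ᵃ[ℝ] X)) :=
    hconv.comp_affineMap (AffineMap.lineMap u y : ℝ →ᵃ[ℝ] X)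
  have hd : HasDerivAt (f ∘ (AffineMap.lineMap u y : ℝ →ᵃ[ℝ] X)) ⟪g, y - u⟫ 0 := by
    have h1 : HasDerivAt (AffineMap.lineMap u y : ℝ →ᵃ[ℝ] X) (y - u) 0 :=
      AffineMap.hasDerivAt_lineMap
    have h2 : HasFDerivAt f (InnerProductSpace.toDual ℝ X g)
        ((AffineMap.lineMap u y : ℝ →ᵃ[ℝ] X) (0 : ℝ)) := by
      simpa using hf.hasFDerivAt
    exact h2.comp_hasDerivAt (0 : ℝ) h1
  have := hline.le_slope_of_hasDerivAt (Set.mem_univ 0) (Set.mem_univ 1) one_pos hd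
  simp [slope_def_field] at this
  linarith

/-- A saddle point of the regularized Lagrangian has norm at most that of any saddle point of
the Lagrangian. -/
theorem sq_norm_regularized_saddle_le
    {X Y : Type*} [NormedAddCommGroup X] [InnerProductSpace ℝ X] [CompleteSpace X]
    [NormedAddCommGroup Y] [InnerProductSpace ℝ Y] [CompleteSpace Y]
    {f : X → ℝ} {g : X} (hconv : ConvexOn ℝ Set.univ f) {A : X →L[ℝ] Y} {b : Y}
    {xs u : X} {ls l : Y} {ε : ℝ} (hε : 0 < ε) (hf : HasGradientAt f g u)
    (hfeas : A xs = b) (hs : ∀ v, f xs ≤ f v + ⟪ls, A v - b⟫)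
    (hx : g + ContinuousLinearMap.adjoint A l + ε • u = 0) (hl : A u - b - ε • l = 0) :
    ‖u‖ ^ 2 + ‖l‖ ^ 2 ≤ ‖xs‖ ^ 2 + ‖ls‖ ^ 2 := by
  have h1 := hconv.add_inner_le_of_hasGradientAt hf xs
  have h2 := hs u
  have hg : g = -(ContinuousLinearMap.adjoint A l) - ε • u := by
    rw [← sub_eq_zero, ← hx]; abel
  have hA : A u - b = ε • l := sub_eq_zero.mp hl
  have hA' : A (xs - u) = -(ε • l) := by rw [map_sub, hfeas, ← hA]; abel
  rw [hg, inner_sub_left, inner_neg_left, ContinuousLinearMap.adjoint_inner_left, hA'] at h1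
  rw [hA] at h2
  simp only [inner_neg_right, inner_smul_left, inner_smul_right, inner_sub_right,
    real_inner_self_eq_norm_sq, RCLike.conj_to_real] at h1 h2
  have h3 : ε * (‖u‖ ^ 2 + ‖l‖ ^ 2) ≤ ε * (⟪u, xs⟫ + ⟪ls, l⟫) := by linarith
  have h4 := le_of_mul_le_mul_left h3 hε
  have h5 := real_inner_le_norm u xs
  have h6 := real_inner_le_norm ls l
  nlinarith [sq_nonneg (‖u‖ - ‖xs‖), sq_nonneg (‖ls‖ - ‖l‖)]

theorem sq_norm_sub_regularized_saddle_le
    {X Y : Type*} [NormedAddCommGroup X] [InnerProductSpace ℝ X] [CompleteSpace X]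
    [NormedAddCommGroup Y] [InnerProductSpace ℝ Y] [CompleteSpace Y]
    {f : X → ℝ} {f' : X → X} (hf : ∀ u, HasGradientAt f (f' u) u)
    (hconv : ConvexOn ℝ Set.univ f) {A : X →L[ℝ] Y} {b : Y}
    {u v : X} {l k : Y} {ε η : ℝ} (hε : 0 < ε)
    (hu : f' u + ContinuousLinearMap.adjoint A l + ε • u = 0) (hl : A u - b - ε • l = 0)
    (hv : f' v + ContinuousLinearMap.adjoint A k + η • v = 0) (hk : A v - b - η • k = 0) :
    ε ^ 2 * (‖v - u‖ ^ 2 + ‖k - l‖ ^ 2) ≤ (η - ε) ^ 2 * (‖v‖ ^ 2 + ‖k‖ ^ 2) := by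
  have h1 := hconv.add_inner_le_of_hasGradientAt (hf u) v
  have h2 := hconv.add_inner_le_of_hasGradientAt (hf v) u
  have h3 : 0 ≤ ⟪f' v - f' u, v - u⟫ := by
    rw [← neg_sub v u, inner_neg_right] at h2
    rw [inner_sub_left]; linarith
  have hd : f' v - f' u
      = -(ContinuousLinearMap.adjoint A (k - l)) - (ε • (v - u) + (η - ε) • v) := by
    rw [map_sub]
    linear_combination (norm := module) hv - hu
  have hA : A (v - u) = ε • (k - l) + (η - ε) • k := by
    rw [map_sub]
    linear_combination (norm := module) hk - hl
  rw [hd, inner_sub_left, inner_neg_left, ContinuousLinearMap.adjoint_inner_left, hA] at h3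
  simp only [inner_add_left, inner_add_right, inner_smul_left, inner_smul_right,
    real_inner_self_eq_norm_sq, RCLike.conj_to_real] at h3
  have h5 := norm_inner_le_norm (𝕜 := ℝ) v (v - u)
  have h6 := norm_inner_le_norm (𝕜 := ℝ) (k - l) k
  rw [Real.norm_eq_abs] at h5 h6
  have h7 : ε * (‖v - u‖ ^ 2 + ‖k - l‖ ^ 2) ≤ |η - ε| * (‖v‖ * ‖v - u‖ + ‖k - l‖ * ‖k‖) := by
    have : -((η - ε) * (⟪v, v - u⟫ + ⟪k - l, k⟫))
        ≤ |η - ε| * (‖v‖ * ‖v - u‖ + ‖k - l‖ * ‖k‖) := by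
      refine (neg_le_abs _).trans ?_
      rw [abs_mul]
      gcongr
      exact (abs_add_le _ _).trans (add_le_add h5 h6)
    linarith
  have h8 := mul_le_mul_of_nonneg_left h7 hε.le
  have h9 := sq_nonneg (ε * ‖v - u‖ - |η - ε| * ‖v‖)
  have h10 := sq_nonneg (ε * ‖k - l‖ - |η - ε| * ‖k‖)
  rw [← sq_abs (η - ε)]
  nlinarith

theorem sq_norm_deriv_regularized_saddle_le
    {X Y : Type*} [NormedAddCommGroup X] [InnerProductSpace ℝ X] [CompleteSpace X]
    [NormedAddCommGroup Y] [InnerProductSpace ℝ Y] [CompleteSpace Y]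
    {f : X → ℝ} {f' : X → X} (hf : ∀ u, HasGradientAt f (f' u) u)
    (hconv : ConvexOn ℝ Set.univ f) {A : X →L[ℝ] Y} {b : Y}
    {u : ℝ → X} {l : ℝ → Y} {ε : ℝ → ℝ} {t N ε' : ℝ} {u' : X} {l' : Y} (hε : 0 < ε t)
    (hu : ∀ᶠ r in 𝓝 t, f' (u r) + ContinuousLinearMap.adjoint A (l r) + ε r • u r = 0)
    (hl : ∀ᶠ r in 𝓝 t, A (u r) - b - ε r • l r = 0)
    (hN : ∀ᶠ r in 𝓝 t, ‖u r‖ ^ 2 + ‖l r‖ ^ 2 ≤ N)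
    (hu' : HasDerivAt u u' t) (hl' : HasDerivAt l l' t) (hε' : HasDerivAt ε ε' t) :
    ε t ^ 2 * (‖u'‖ ^ 2 + ‖l'‖ ^ 2) ≤ ε' ^ 2 * N := by
  have T1 := hasDerivAt_iff_tendsto_slope.mp hu'
  have T2 := hasDerivAt_iff_tendsto_slope.mp hl'
  have T3 := hasDerivAt_iff_tendsto_slope.mp hε'
  refine le_of_tendsto_of_tendsto
    (((T1.norm.pow 2).add (T2.norm.pow 2)).const_mul (ε t ^ 2)) ((T3.pow 2).mul_const N) ?_
  filter_upwards [nhdsWithin_le_nhds hu, nhdsWithin_le_nhds hl, nhdsWithin_le_nhds hN]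
    with r h1 h2 h3
  have := sq_norm_sub_regularized_saddle_le hf hconv hε hu.self_of_nhds hl.self_of_nhds h1 h2
  simp only [slope_def_module, norm_smul, mul_pow, norm_inv, smul_eq_mul, Real.norm_eq_abs,
    sq_abs, inv_pow]
  have h4 : (0:ℝ) ≤ ((r - t) ^ 2)⁻¹ := by positivity
  have h5 : (ε r - ε t) ^ 2 * (‖u r‖ ^ 2 + ‖l r‖ ^ 2) ≤ (ε r - ε t) ^ 2 * N := by gcongr
  have h6 := mul_le_mul_of_nonneg_left (this.trans h5) h4
  linarith

theorem mul_le_mul_sq_add_sq_div {r : ℝ} (hr : 0 < r) (a b : ℝ) :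
    a * b ≤ r * a ^ 2 + b ^ 2 / (4 * r) := by
  have h : r * a ^ 2 + b ^ 2 / (4 * r) - a * b = (2 * r * a - b) ^ 2 / (4 * r) := by
    field_simp; ring
  have : 0 ≤ (2 * r * a - b) ^ 2 / (4 * r) := by positivity
  linarith

set_option maxHeartbeats 1000000 in
/-- Scalar dissipation estimate: absorption of the cross terms by Young's inequality. -/
theorem exists_dissipation_bound {ν c γ k K B : ℝ} (hν : 0 < ν) (hc : 0 < c) (hγ : 0 < γ)
    (hk : 0 < k) (hK : 0 ≤ K) (hB : 0 ≤ B) :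
    ∃ μ > 0, ∃ C ≥ 0, ∀ t T S P m δ β β' a a' u w y g Δ D E : ℝ, 0 < t → 1 ≤ T → 1 ≤ S →
      1 ≤ P → 0 < m → T ^ 2 * S ≤ P → P ^ 2 ≤ t → γ ≤ m * T * S → m * T ≤ k →
      T * S / 2 ≤ δ → 1 / 2 ≤ a → a ≤ 2 → 0 ≤ β → β ≤ 3 * (m * T ^ 2 * S) →
      β' ≤ ν / 8 * (T * S) → a' ≤ c / 8 * (T * S / P) →
      0 ≤ u → 0 ≤ w → 0 ≤ Δ →
      D ≤ β' * Δ + K / t * (β * B + ν ^ 2 + ν * a) * u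
        - ν * δ * (Δ + c / P / 2 * u ^ 2 + c / P * w ^ 2) - a * m * T * y ^ 2
        - γ * δ * T * g ^ 2 + ν * T * (m * y + γ * g) * (K / t) + w * (K / t)
        + ν / 2 * a' * u ^ 2 →
      E ≤ β * Δ + 3 / 2 * (ν ^ 2 * u ^ 2 + T ^ 2 * m ^ 2 * y ^ 2 + γ ^ 2 * T ^ 2 * g ^ 2)
        + ν / 2 * a * u ^ 2 + 1 / 2 * w ^ 2 →
      D + μ * (T * S / P) * E ≤ C * (T * S / P) * (m * T / t) := by
  obtain ⟨μ, hμ, hμ1, hμ2, hμ3, hμ4, hμ5⟩ : ∃ μ : ℝ, 0 < μ ∧ μ * (3 * k) ≤ ν / 8 ∧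
      μ * (3 / 2 * ν ^ 2 + ν) ≤ ν * c / 16 ∧ μ ≤ ν * c / 4 ∧ μ * (3 / 2 * k) ≤ 1 / 8 ∧
      μ * (3 / 2 * γ ^ 2) ≤ γ / 8 := by
    have key : ∀ z r : ℝ, 0 < z → 0 < r → ∀ᶠ μ in 𝓝[>] (0:ℝ), μ * z ≤ r := by
      intro z r hz hr
      filter_upwards [Ioo_mem_nhdsGT (div_pos hr hz)] with μ hμ
      exact ((lt_div_iff₀ hz).mp hμ.2).le
    have h := (((((key (3 * k) (ν / 8) (by positivity) (by positivity)).and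
      (key (3 / 2 * ν ^ 2 + ν) (ν * c / 16) (by positivity) (by positivity))).and
      (key 1 (ν * c / 4) (by positivity) (by positivity))).and
      (key (3 / 2 * k) (1 / 8) (by positivity) (by positivity))).and
      (key (3 / 2 * γ ^ 2) (γ / 8) (by positivity) (by positivity))).and self_mem_nhdsWithin
    obtain ⟨μ, ⟨⟨⟨⟨h1, h2⟩, h3⟩, h4⟩, h5⟩, h6⟩ := h.exists
    exact ⟨μ, h6, h1, h2, by simpa using h3, h4, h5⟩
  set Q₁ : ℝ := (K * (B + ν ^ 2 + 2 * ν)) ^ 2 * (4 / (ν * c)) with hQ₁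
  set Q₂ : ℝ := K ^ 2 * (2 / (ν * c)) with hQ₂
  refine ⟨μ, hμ, Q₁ * (18 * k + 2 / γ) + Q₂ / γ + 2 * ν ^ 2 * K ^ 2 + 2 * ν ^ 2 * K ^ 2,
    by positivity, ?_⟩
  intro t T S P m δ β β' a a' u w y g Δ D E ht hT hS hP hm hTSP hPt hγm hmk hδ ha1 ha2 hβ0 hβ
    hβ' ha' hu hw hΔ hD hE
  have hT0 : 0 < T := by linarith
  have hS0 : 0 < S := by linarith
  have hP0 : 0 < P := by linarith
  have hTS : 1 ≤ T * S := one_le_mul_of_one_le_of_one_le hT hS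
  set ρ : ℝ := T * S / P with hρ
  have hρ0 : 0 < ρ := by positivity
  have hρ1 : ρ ≤ 1 := by
    rw [hρ, div_le_one hP0]
    calc T * S ≤ T ^ 2 * S := by gcongr; exact le_self_pow₀ hT two_ne_zero
      _ ≤ P := hTSP
  have hρP : ρ * P = T * S := by rw [hρ]; field_simp
  have hρt : T ^ 2 * S ^ 2 ≤ ρ ^ 2 * t := by
    calc T ^ 2 * S ^ 2 = ρ ^ 2 * P ^ 2 := by rw [← mul_pow, ← mul_pow, hρP]
      _ ≤ ρ ^ 2 * t := by gcongr
  have hinv : 1 / t ≤ ρ := by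
    rw [div_le_iff₀ ht]
    have h1 : ρ * P ≤ ρ * t := by
      gcongr
      exact (le_self_pow₀ hP two_ne_zero).trans hPt
    linarith
  have hone : 1 ≤ m * T ^ 3 * S ^ 2 / γ := by
    rw [le_div_iff₀ hγ, one_mul]
    refine hγm.trans ?_
    calc m * T * S = m * T * S * 1 := by ring
      _ ≤ m * T * S * (T ^ 2 * S) := by
        gcongr
        exact one_le_mul_of_one_le_of_one_le (one_le_pow₀ hT) hS
      _ = m * T ^ 3 * S ^ 2 := by ring
  have hH : m * T ^ 3 * S ^ 2 / (t ^ 2 * ρ) ≤ ρ * (m * T / t) := by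
    rw [div_le_iff₀ (by positivity)]
    calc m * T ^ 3 * S ^ 2 = m * T * (T ^ 2 * S ^ 2) := by ring
      _ ≤ m * T * (ρ ^ 2 * t) := by gcongr
      _ = ρ * (m * T / t) * (t ^ 2 * ρ) := by field_simp
  have hbase : 1 / (t ^ 2 * ρ) ≤ ρ * (m * T / t) / γ := by
    calc 1 / (t ^ 2 * ρ) ≤ (m * T ^ 3 * S ^ 2 / γ) / (t ^ 2 * ρ) := by gcongr
      _ = (m * T ^ 3 * S ^ 2 / (t ^ 2 * ρ)) / γ := by ring
      _ ≤ _ := by gcongr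
  have hβsq : (β + 1) ^ 2 ≤ (18 * k + 2 / γ) * (m * T ^ 3 * S ^ 2) := by
    have h1 : β ^ 2 ≤ 9 * k * (m * T ^ 3 * S ^ 2) := by
      calc β ^ 2 ≤ (3 * (m * T ^ 2 * S)) ^ 2 := by gcongr
        _ = 9 * (m * T) * (m * T ^ 3 * S ^ 2) := by ring
        _ ≤ 9 * k * (m * T ^ 3 * S ^ 2) := by gcongr
    have h2 : (18 * k + 2 / γ) * (m * T ^ 3 * S ^ 2)
        = 2 * (9 * k * (m * T ^ 3 * S ^ 2)) + 2 * (m * T ^ 3 * S ^ 2 / γ) := by ring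
    have h3 : (β + 1) ^ 2 ≤ 2 * β ^ 2 + 2 * 1 := by linarith [sq_nonneg (β - 1)]
    linarith
  have hβk : β ≤ 3 * k * (T * S) := by
    calc β ≤ 3 * (m * T ^ 2 * S) := hβ
      _ = 3 * (m * T) * (T * S) := by ring
      _ ≤ _ := by gcongr
  -- linear terms
  have y1 : K / t * (β * B + ν ^ 2 + ν * a) * u
      ≤ ν * c / 16 * ρ * u ^ 2 + Q₁ * (18 * k + 2 / γ) * (ρ * (m * T / t)) := by
    have h0 : β * B + ν ^ 2 + ν * a ≤ (B + ν ^ 2 + 2 * ν) * (β + 1) := by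
      have : 0 ≤ ν ^ 2 * β + 2 * ν * β + B + ν * (2 - a) := by
        have := sub_nonneg.mpr ha2
        positivity
      linarith
    calc K / t * (β * B + ν ^ 2 + ν * a) * u
        ≤ K / t * ((B + ν ^ 2 + 2 * ν) * (β + 1)) * u := by gcongr
      _ = u * (K / t * ((B + ν ^ 2 + 2 * ν) * (β + 1))) := by ring
      _ ≤ _ := mul_le_mul_sq_add_sq_div (r := ν * c / 16 * ρ) (by positivity) _ _
      _ = ν * c / 16 * ρ * u ^ 2 + Q₁ * ((β + 1) ^ 2 / (t ^ 2 * ρ)) := by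
        rw [hQ₁]; field_simp; ring
      _ ≤ ν * c / 16 * ρ * u ^ 2
          + Q₁ * ((18 * k + 2 / γ) * (m * T ^ 3 * S ^ 2) / (t ^ 2 * ρ)) := by gcongr
      _ = ν * c / 16 * ρ * u ^ 2
          + Q₁ * (18 * k + 2 / γ) * (m * T ^ 3 * S ^ 2 / (t ^ 2 * ρ)) := by ring
      _ ≤ _ := by gcongr
  have y2 : w * (K / t) ≤ ν * c / 8 * ρ * w ^ 2 + Q₂ / γ * (ρ * (m * T / t)) := by
    calc w * (K / t) ≤ _ := mul_le_mul_sq_add_sq_div (r := ν * c / 8 * ρ) (by positivity) _ _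
      _ = ν * c / 8 * ρ * w ^ 2 + Q₂ * (1 / (t ^ 2 * ρ)) := by rw [hQ₂]; field_simp; ring
      _ ≤ ν * c / 8 * ρ * w ^ 2 + Q₂ * (ρ * (m * T / t) / γ) := by gcongr
      _ = _ := by ring
  have y3 : ν * T * (m * y) * (K / t)
      ≤ 1 / 8 * (m * T) * y ^ 2 + 2 * ν ^ 2 * K ^ 2 * (ρ * (m * T / t)) := by
    calc ν * T * (m * y) * (K / t) = y * (ν * T * m * (K / t)) := by ring
      _ ≤ _ := mul_le_mul_sq_add_sq_div (r := 1 / 8 * (m * T)) (by positivity) _ _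
      _ = 1 / 8 * (m * T) * y ^ 2 + 2 * ν ^ 2 * K ^ 2 * (1 / t * (m * T / t)) := by
        field_simp; ring
      _ ≤ _ := by gcongr
  have y4 : ν * T * (γ * g) * (K / t)
      ≤ γ / 8 * (T ^ 2 * S) * g ^ 2 + 2 * ν ^ 2 * K ^ 2 * (ρ * (m * T / t)) := by
    calc ν * T * (γ * g) * (K / t) = g * (ν * T * γ * (K / t)) := by ring
      _ ≤ _ := mul_le_mul_sq_add_sq_div (r := γ / 8 * (T ^ 2 * S)) (by positivity) _ _
      _ = γ / 8 * (T ^ 2 * S) * g ^ 2 + 2 * ν ^ 2 * K ^ 2 * (1 / t * (γ / (t * S))) := by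
        field_simp; ring
      _ ≤ γ / 8 * (T ^ 2 * S) * g ^ 2 + 2 * ν ^ 2 * K ^ 2 * (ρ * (m * T / t)) := by
        have : γ / (t * S) ≤ m * T / t := by
          rw [div_le_div_iff₀ (by positivity) ht]
          calc γ * t ≤ m * T * S * t := by gcongr
            _ = m * T * (t * S) := by ring
        gcongr
  -- reservoir of dissipation
  have r1 : T * S / 2 * (ν * Δ) + ν * c / 4 * ρ * u ^ 2 + ν * c / 2 * ρ * w ^ 2
      ≤ ν * δ * (Δ + c / P / 2 * u ^ 2 + c / P * w ^ 2) := by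
    calc _ = ν * (T * S / 2) * (Δ + c / P / 2 * u ^ 2 + c / P * w ^ 2) := by
          rw [hρ]; field_simp; ring
      _ ≤ _ := by gcongr
  have r2 : 1 / 2 * (m * T) * y ^ 2 ≤ a * m * T * y ^ 2 := by
    calc _ = 1 / 2 * m * T * y ^ 2 := by ring
      _ ≤ _ := by gcongr
  have r3 : γ / 2 * (T ^ 2 * S) * g ^ 2 ≤ γ * δ * T * g ^ 2 := by
    calc _ = γ * (T * S / 2) * T * g ^ 2 := by ring
      _ ≤ _ := by gcongr
  have r4 : β' * Δ ≤ ν / 8 * (T * S) * Δ := by gcongr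
  have r5 : ν / 2 * a' * u ^ 2 ≤ ν * c / 16 * ρ * u ^ 2 := by
    calc _ ≤ ν / 2 * (c / 8 * ρ) * u ^ 2 := by gcongr
      _ = _ := by ring
  -- energy terms
  have e1 : μ * ρ * (β * Δ) ≤ ν / 8 * (T * S) * Δ := by
    calc μ * ρ * (β * Δ) ≤ μ * 1 * (3 * k * (T * S) * Δ) := by gcongr
      _ = μ * (3 * k) * (T * S * Δ) := by ring
      _ ≤ ν / 8 * (T * S * Δ) := by gcongr
      _ = _ := by ring
  have e2 : μ * ρ * (3 / 2 * (ν ^ 2 * u ^ 2) + ν / 2 * a * u ^ 2)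
      ≤ ν * c / 16 * ρ * u ^ 2 := by
    calc _ ≤ μ * ρ * (3 / 2 * (ν ^ 2 * u ^ 2) + ν / 2 * 2 * u ^ 2) := by gcongr
      _ = μ * (3 / 2 * ν ^ 2 + ν) * (ρ * u ^ 2) := by ring
      _ ≤ ν * c / 16 * (ρ * u ^ 2) := by gcongr
      _ = _ := by ring
  have e3 : μ * ρ * (3 / 2 * (T ^ 2 * m ^ 2 * y ^ 2)) ≤ 1 / 8 * (m * T) * y ^ 2 := by
    calc _ ≤ μ * 1 * (3 / 2 * (T ^ 2 * m ^ 2 * y ^ 2)) := by gcongr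
      _ = μ * (3 / 2 * (m * T)) * (m * T * y ^ 2) := by ring
      _ ≤ μ * (3 / 2 * k) * (m * T * y ^ 2) := by gcongr
      _ ≤ 1 / 8 * (m * T * y ^ 2) := by gcongr
      _ = _ := by ring
  have e4 : μ * ρ * (3 / 2 * (γ ^ 2 * T ^ 2 * g ^ 2)) ≤ γ / 8 * (T ^ 2 * S) * g ^ 2 := by
    calc _ ≤ μ * 1 * (3 / 2 * (γ ^ 2 * T ^ 2 * g ^ 2)) := by gcongr
      _ = μ * (3 / 2 * γ ^ 2) * (T ^ 2 * 1 * g ^ 2) := by ring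
      _ ≤ γ / 8 * (T ^ 2 * S * g ^ 2) := by gcongr
      _ = _ := by ring
  have e5 : μ * ρ * (1 / 2 * w ^ 2) ≤ ν * c / 8 * ρ * w ^ 2 := by
    calc _ = μ * (1 / 2 * ρ * w ^ 2) := by ring
      _ ≤ ν * c / 4 * (1 / 2 * ρ * w ^ 2) := by gcongr
      _ = _ := by ring
  have eE : μ * ρ * E ≤ μ * ρ * (β * Δ) + μ * ρ * (3 / 2 * (ν ^ 2 * u ^ 2) + ν / 2 * a * u ^ 2)
      + μ * ρ * (3 / 2 * (T ^ 2 * m ^ 2 * y ^ 2)) + μ * ρ * (3 / 2 * (γ ^ 2 * T ^ 2 * g ^ 2))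
      + μ * ρ * (1 / 2 * w ^ 2) := by
    refine (mul_le_mul_of_nonneg_left hE (by positivity)).trans (le_of_eq ?_)
    ring
  have p1 : 0 ≤ T * S * (ν * Δ) := by positivity
  have p2 : 0 ≤ ν * c * ρ * u ^ 2 := by positivity
  have p3 : 0 ≤ ν * c * ρ * w ^ 2 := by positivity
  have p4 : 0 ≤ m * T * y ^ 2 := by positivity
  have p5 : 0 ≤ γ * (T ^ 2 * S) * g ^ 2 := by positivity
  linarith

section Energy
variable {X Y : Type*} [NormedAddCommGroup X] [InnerProductSpace ℝ X]
  [NormedAddCommGroup Y] [InnerProductSpace ℝ Y]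

/-- Gap `L_t(u, l) - L_t(v, l)` of the regularized Lagrangian with regularization weight `κ`. -/
noncomputable def lagrangianGap (f : X → ℝ) (A : X →L[ℝ] Y) (κ : ℝ) (u v : X) (l : Y) : ℝ :=
  f u - f v + ⟪l, A (u - v)⟫ + κ / 2 * (‖u‖ ^ 2 - ‖v‖ ^ 2)

/-- Lyapunov function of the primal-dual dynamics. -/
noncomputable def lyapunovEnergy (f : X → ℝ) (A : X →L[ℝ] Y) (ν γ : ℝ) (β κ a m T : ℝ → ℝ)
    (x x' G xt : ℝ → X) (lam lt : ℝ → Y) (t : ℝ) : ℝ :=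
  β t * lagrangianGap f A (κ t) (x t) (xt t) (lt t)
    + 1 / 2 * ‖ν • (x t - xt t) + T t • (m t • x' t + γ • G t)‖ ^ 2
    + ν / 2 * (a t * ‖x t - xt t‖ ^ 2) + 1 / 2 * ‖lam t - lt t‖ ^ 2

theorem lyapunovEnergy_deriv_le {A : X →L[ℝ] Y} {e w z G g : X} {η ζ : Y}
    {ν γ κ c a a' β m T δ gap β' σ K t : ℝ} (hν : 0 ≤ ν) (hγ : 0 ≤ γ) (hδ : 0 ≤ δ) (hβ : 0 ≤ β)
    (ha : 0 ≤ a) (hm : 0 ≤ m) (hT : 0 ≤ T) (hz : ‖z‖ ≤ K / t) (hζ : ‖ζ‖ ≤ K / t)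
    (hσ : σ ≤ c * (K / t) * ‖e‖) (hgap : gap + κ / 2 * ‖e‖ ^ 2 ≤ ⟪e, g⟫) :
    β' * gap + β * ⟪ζ, A e⟫ + β * σ - ν * δ * (⟪e, g⟫ + κ * ‖η‖ ^ 2)
        - a * m * T * ‖w‖ ^ 2 - γ * δ * T * ‖G‖ ^ 2 - (ν ^ 2 + ν * a) * ⟪e, z⟫
        - ν * T * (m * ⟪w, z⟫ + γ * ⟪G, z⟫) - ⟪η, ζ⟫ + ν / 2 * a' * ‖e‖ ^ 2
      ≤ β' * gap + K / t * (β * (‖A‖ + c) + ν ^ 2 + ν * a) * ‖e‖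
        - ν * δ * (gap + κ / 2 * ‖e‖ ^ 2 + κ * ‖η‖ ^ 2) - a * m * T * ‖w‖ ^ 2
        - γ * δ * T * ‖G‖ ^ 2 + ν * T * (m * ‖w‖ + γ * ‖G‖) * (K / t) + ‖η‖ * (K / t)
        + ν / 2 * a' * ‖e‖ ^ 2 := by
  have hz' : ∀ v : X, -⟪v, z⟫ ≤ ‖v‖ * (K / t) := fun v =>
    (neg_le_abs _).trans ((abs_real_inner_le_norm v z).trans (by gcongr))
  have hη : -⟪η, ζ⟫ ≤ ‖η‖ * (K / t) :=
    (neg_le_abs _).trans ((abs_real_inner_le_norm η ζ).trans (by gcongr))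
  have hAe : ⟪ζ, A e⟫ ≤ K / t * (‖A‖ * ‖e‖) :=
    (real_inner_le_norm _ _).trans
      (mul_le_mul hζ (A.le_opNorm e) (norm_nonneg _) ((norm_nonneg _).trans hζ))
  have i1 := mul_le_mul_of_nonneg_left hAe hβ
  have i2 := mul_le_mul_of_nonneg_left hσ hβ
  have i3 := mul_le_mul_of_nonneg_left hgap (mul_nonneg hν hδ)
  have i4 := mul_le_mul_of_nonneg_left (hz' e) (by positivity : 0 ≤ ν ^ 2 + ν * a)
  have i5 := mul_le_mul_of_nonneg_left (hz' w) (by positivity : 0 ≤ ν * T * m)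
  have i6 := mul_le_mul_of_nonneg_left (hz' G) (by positivity : 0 ≤ ν * T * γ)
  linarith

theorem sq_norm_smul_add_le {e w G : X} {ν γ m T : ℝ} :
    ‖ν • e + T • (m • w + γ • G)‖ ^ 2
      ≤ 3 * (ν ^ 2 * ‖e‖ ^ 2 + T ^ 2 * m ^ 2 * ‖w‖ ^ 2 + γ ^ 2 * T ^ 2 * ‖G‖ ^ 2) := by
  have h1 : ‖ν • e + T • (m • w + γ • G)‖ ≤ |ν| * ‖e‖ + (|T| * |m| * ‖w‖ + |T| * |γ| * ‖G‖) := by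
    rw [smul_add, smul_smul, smul_smul]
    refine (norm_add_le _ _).trans (add_le_add (norm_smul _ _).le
      ((norm_add_le _ _).trans (add_le_add ?_ ?_))) <;> rw [norm_smul, norm_mul] <;> rfl
  have h2 := pow_le_pow_left₀ (norm_nonneg _) h1 2
  have e1 : (|ν| * ‖e‖) ^ 2 = ν ^ 2 * ‖e‖ ^ 2 := by rw [mul_pow, sq_abs]
  have e2 : (|T| * |m| * ‖w‖) ^ 2 = T ^ 2 * m ^ 2 * ‖w‖ ^ 2 := by
    rw [mul_pow, mul_pow, sq_abs, sq_abs]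
  have e3 : (|T| * |γ| * ‖G‖) ^ 2 = γ ^ 2 * T ^ 2 * ‖G‖ ^ 2 := by
    rw [mul_pow, mul_pow, sq_abs, sq_abs]; ring
  nlinarith [sq_nonneg (|ν| * ‖e‖ - |T| * |m| * ‖w‖), sq_nonneg (|ν| * ‖e‖ - |T| * |γ| * ‖G‖),
    sq_nonneg (|T| * |m| * ‖w‖ - |T| * |γ| * ‖G‖)]
variable [CompleteSpace X] [CompleteSpace Y]

theorem le_lagrangianGap {f : X → ℝ} {A : X →L[ℝ] Y}
    {κ : ℝ} {u v g : X} {l : Y} (hgrad : ∀ y, f v + ⟪g, y - v⟫ ≤ f y)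
    (h : g + ContinuousLinearMap.adjoint A l + κ • v = 0) :
    κ / 2 * ‖u - v‖ ^ 2 ≤ lagrangianGap f A κ u v l := by
  have h1 := hgrad u
  have h2 : ⟪g + ContinuousLinearMap.adjoint A l + κ • v, u - v⟫ = 0 := by
    rw [h, inner_zero_left]
  rw [inner_add_left, inner_add_left, ContinuousLinearMap.adjoint_inner_left,
    inner_smul_left, inner_sub_right v, real_inner_self_eq_norm_sq] at h2
  have h3 := norm_sub_sq_real u v
  rw [real_inner_comm] at h3
  simp only [RCLike.conj_to_real] at h2
  unfold lagrangianGap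
  rw [h3]
  linarith

theorem lagrangianGap_add_le {f : X → ℝ} {A : X →L[ℝ] Y}
    {κ : ℝ} {u v g : X} {l : Y} (hgrad : ∀ y, f u + ⟪g, y - u⟫ ≤ f y) :
    lagrangianGap f A κ u v l + κ / 2 * ‖u - v‖ ^ 2
      ≤ ⟪u - v, g + ContinuousLinearMap.adjoint A l + κ • u⟫ := by
  have h1 := hgrad v
  rw [real_inner_comm, inner_add_left, inner_add_left, ContinuousLinearMap.adjoint_inner_left,
    inner_smul_left, inner_sub_right u, real_inner_self_eq_norm_sq]
  have h3 := norm_sub_sq_real u v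
  rw [← neg_sub u v, inner_neg_right] at h1
  simp only [RCLike.conj_to_real]
  unfold lagrangianGap
  rw [h3]
  linarith

theorem hasDerivAt_lyapunovEnergy {f : X → ℝ} {f' : X → X} (hf : ∀ u, HasGradientAt f (f' u) u)
    {A : X →L[ℝ] Y} {ν γ : ℝ} {β κ a m T : ℝ → ℝ} {x x' G xt : ℝ → X} {lam lt : ℝ → Y}
    {t β' κ' a' m' T' : ℝ} {x'' G' xt' v' : X} {lam' lt' : Y}
    (hβ : HasDerivAt β β' t) (hκ : HasDerivAt κ κ' t) (ha : HasDerivAt a a' t)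
    (hm : HasDerivAt m m' t) (hT : HasDerivAt T T' t) (hx : HasDerivAt x (x' t) t)
    (hx' : HasDerivAt x' x'' t) (hG : HasDerivAt G G' t) (hxt : HasDerivAt xt xt' t)
    (hlam : HasDerivAt lam lam' t) (hlt : HasDerivAt lt lt' t)
    (hstat : f' (xt t) + ContinuousLinearMap.adjoint A (lt t) + κ t • xt t = 0)
    (hv : ν • (x' t - xt') + (T' • (m t • x' t + γ • G t)
      + T t • (m' • x' t + m t • x'' + γ • G')) = v') :
    HasDerivAt (lyapunovEnergy f A ν γ β κ a m T x x' G xt lam lt)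
      (β' * lagrangianGap f A (κ t) (x t) (xt t) (lt t)
        + β t * (⟪x' t, f' (x t) + ContinuousLinearMap.adjoint A (lt t) + κ t • x t⟫
          + ⟪lt', A (x t - xt t)⟫ + κ' / 2 * (‖x t‖ ^ 2 - ‖xt t‖ ^ 2))
        + ⟪ν • (x t - xt t) + T t • (m t • x' t + γ • G t), v'⟫
        + ν / 2 * (a' * ‖x t - xt t‖ ^ 2 + a t * (2 * ⟪x t - xt t, x' t - xt'⟫))
        + ⟪lam t - lt t, lam' - lt'⟫) t := by
  have hfx : HasDerivAt (fun r => f (x r)) ⟪f' (x t), x' t⟫ t := by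
    exact (hf (x t)).hasFDerivAt.comp_hasDerivAt t hx
  have hfxt : HasDerivAt (fun r => f (xt r)) ⟪f' (xt t), xt'⟫ t := by
    exact (hf (xt t)).hasFDerivAt.comp_hasDerivAt t hxt
  have he := hx.sub hxt
  have hAe : HasDerivAt (fun r => A (x r - xt r)) (A (x' t - xt')) t :=
    A.hasFDerivAt.comp_hasDerivAt t he
  have hgap : HasDerivAt (fun r => lagrangianGap f A (κ r) (x r) (xt r) (lt r))
      (⟪x' t, f' (x t) + ContinuousLinearMap.adjoint A (lt t) + κ t • x t⟫
          + ⟪lt', A (x t - xt t)⟫ + κ' / 2 * (‖x t‖ ^ 2 - ‖xt t‖ ^ 2)) t := by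
    have h0 : ⟪xt', f' (xt t) + ContinuousLinearMap.adjoint A (lt t) + κ t • xt t⟫ = 0 := by
      rw [hstat, inner_zero_right]
    refine (((hfx.sub hfxt).add (hlt.inner ℝ hAe)).add
      ((hκ.div_const 2).mul (hx.norm_sq.sub hxt.norm_sq))).congr_deriv ?_
    simp only [inner_add_right, ContinuousLinearMap.adjoint_inner_right, inner_smul_right,
      map_sub, inner_sub_right] at h0 ⊢
    rw [real_inner_comm (x' t) (f' (x t)), real_inner_comm xt' (f' (xt t)),
      real_inner_comm (A (x' t)), real_inner_comm (A xt'), real_inner_comm (x' t) (x t)]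
    rw [real_inner_comm (xt t) xt'] at h0
    simp only [Pi.sub_apply]
    linear_combination (-1 : ℝ) * h0
  have hvel : HasDerivAt (fun r => ν • (x r - xt r) + T r • (m r • x' r + γ • G r)) v' t := by
    refine ((he.const_smul ν).add (hT.smul ((hm.smul hx').add (hG.const_smul γ)))).congr_deriv ?_
    rw [← hv]
    simp only [Pi.add_apply, Pi.smul_apply', Pi.smul_apply]
    module
  refine ((((hβ.mul hgap).add (hvel.norm_sq.const_mul (1 / 2))).add
    ((ha.mul he.norm_sq).const_mul (ν / 2))).add
    ((hlam.sub hlt).norm_sq.const_mul (1 / 2))).congr_deriv ?_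
  simp only [Pi.sub_apply]
  ring

theorem lyapunovEnergy_deriv_eq {A : X →L[ℝ] Y} {e w z G g : X} {η ζ μ : Y}
    {ν γ κ a a' β m T δ gap β' σ : ℝ} (hG : G = g + ContinuousLinearMap.adjoint A η)
    (hβ : β = T * (m * δ + a * γ))
    (hμ : μ = (ν * δ) • (A e - κ • η) + β • A w) :
    β' * gap + β * (⟪w, g⟫ + ⟪ζ, A e⟫ + σ)
        + ⟪ν • e + T • (m • w + γ • G), -(a • w) - δ • G - ν • z⟫
        + ν / 2 * (a' * ‖e‖ ^ 2 + a * (2 * ⟪e, w - z⟫)) + ⟪η, μ - ζ⟫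
      = β' * gap + β * ⟪ζ, A e⟫ + β * σ - ν * δ * (⟪e, g⟫ + κ * ‖η‖ ^ 2)
        - a * m * T * ‖w‖ ^ 2 - γ * δ * T * ‖G‖ ^ 2 - (ν ^ 2 + ν * a) * ⟪e, z⟫
        - ν * T * (m * ⟪w, z⟫ + γ * ⟪G, z⟫) - ⟪η, ζ⟫ + ν / 2 * a' * ‖e‖ ^ 2 := by
  have h1 : ⟪e, G⟫ = ⟪e, g⟫ + ⟪η, A e⟫ := by
    rw [hG, inner_add_right, ContinuousLinearMap.adjoint_inner_right, real_inner_comm η]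
  have h2 : ⟪w, G⟫ = ⟪w, g⟫ + ⟪η, A w⟫ := by
    rw [hG, inner_add_right, ContinuousLinearMap.adjoint_inner_right, real_inner_comm η]
  clear hG
  rw [hμ]
  simp only [inner_add_left, inner_sub_right, inner_add_right, inner_smul_left,
    inner_smul_right, inner_neg_right, RCLike.conj_to_real, real_inner_self_eq_norm_sq]
  rw [real_inner_comm w G]
  subst hβ
  linear_combination (-(ν * δ)) * h1 + (-(T * (m * δ + a * γ))) * h2

theorem abs_sub_le_lagrangianGap_add {f : X → ℝ} {A : X →L[ℝ] Y} {b : Y} {κ N : ℝ} {u v g xs : X}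
    {l ls : Y} (hκ : 0 ≤ κ) (hgrad : ∀ y, f v + ⟪g, y - v⟫ ≤ f y)
    (hx : g + ContinuousLinearMap.adjoint A l + κ • v = 0) (hl : A v - b - κ • l = 0)
    (hfeas : A xs = b) (hs : ∀ y, f xs ≤ f y + ⟪ls, A y - b⟫)
    (hv : ‖v‖ ≤ N) (hlN : ‖l‖ ≤ N) (hxs : ‖xs‖ ≤ N) (hls : ‖ls‖ ≤ N) :
    |f u - f xs| ≤ |lagrangianGap f A κ u v l| + N * (‖A‖ * ‖u - v‖)
      + κ * (2 * N ^ 2 + ‖u‖ ^ 2) := by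
  have hN : 0 ≤ N := (norm_nonneg _).trans hv
  have hA : A v - b = κ • l := sub_eq_zero.mp hl
  have h1 : |f v - f xs| ≤ κ * N ^ 2 := by
    have i1 := hs v
    have i2 := hgrad xs
    have hg : g = -(ContinuousLinearMap.adjoint A l) - κ • v := by
      rw [← sub_eq_zero, ← hx]; abel
    have hA' : A (xs - v) = -(κ • l) := by rw [map_sub, hfeas, ← hA]; abel
    rw [hg, inner_sub_left, inner_neg_left, ContinuousLinearMap.adjoint_inner_left, hA'] at i2
    rw [hA] at i1
    simp only [inner_neg_right, inner_smul_left, inner_smul_right, inner_sub_right,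
      real_inner_self_eq_norm_sq, RCLike.conj_to_real] at i1 i2
    have i3 : ⟪ls, l⟫ ≤ N ^ 2 := (real_inner_le_norm _ _).trans (by rw [sq]; gcongr)
    have i4 : ⟪v, xs⟫ ≤ N ^ 2 := (real_inner_le_norm _ _).trans (by rw [sq]; gcongr)
    have i5 := mul_le_mul_of_nonneg_left i3 hκ
    have i6 := mul_le_mul_of_nonneg_left i4 hκ
    have i7 : 0 ≤ κ * ‖l‖ ^ 2 := by positivity
    have i8 : 0 ≤ κ * ‖v‖ ^ 2 := by positivity
    rw [abs_le]
    constructor <;> linarith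
  have h2 : |⟪l, A (u - v)⟫| ≤ N * (‖A‖ * ‖u - v‖) :=
    (abs_real_inner_le_norm _ _).trans (mul_le_mul hlN (A.le_opNorm _) (norm_nonneg _) hN)
  have h3 : |κ / 2 * (‖u‖ ^ 2 - ‖v‖ ^ 2)| ≤ κ * (N ^ 2 + ‖u‖ ^ 2) := by
    have j1 : ‖v‖ ^ 2 ≤ N ^ 2 := by gcongr
    rw [abs_mul, abs_of_nonneg (by positivity)]
    have j2 : |‖u‖ ^ 2 - ‖v‖ ^ 2| ≤ N ^ 2 + ‖u‖ ^ 2 := by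
      rw [abs_le]
      constructor <;> linarith [sq_nonneg ‖u‖, sq_nonneg ‖v‖]
    have j3 : 0 ≤ N ^ 2 + ‖u‖ ^ 2 := by positivity
    gcongr
    linarith
  have h4 : f u - f xs = lagrangianGap f A κ u v l - ⟪l, A (u - v)⟫
      - κ / 2 * (‖u‖ ^ 2 - ‖v‖ ^ 2) + (f v - f xs) := by
    unfold lagrangianGap; ring
  rw [h4]
  refine (abs_add_le _ _).trans ?_
  have h5 := abs_sub (lagrangianGap f A κ u v l - ⟪l, A (u - v)⟫) (κ / 2 * (‖u‖ ^ 2 - ‖v‖ ^ 2))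
  have h6 := abs_sub (lagrangianGap f A κ u v l) ⟪l, A (u - v)⟫
  linarith
end Energy

theorem exists_le_const_mul_of_deriv_le {E E' h h' ρ : ℝ → ℝ} {μ C r : ℝ} (hμ : 0 < μ)
    (hC : 0 ≤ C) (hE : ∀ t ≥ r, HasDerivAt E (E' t) t) (hh : ∀ t ≥ r, HasDerivAt h (h' t) t)
    (hpos : ∀ t ≥ r, 0 < h t) (hρ : ∀ t ≥ r, 0 < ρ t)
    (hE' : ∀ t ≥ r, E' t + μ * ρ t * E t ≤ C * ρ t * h t)
    (hh' : ∀ t ≥ r, -(μ / 2 * ρ t * h t) ≤ h' t) :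
    ∃ K > 0, ∀ t ≥ r, E t ≤ K * h t := by
  refine ⟨2 * C / μ + 1 + |E r / h r|, by positivity, fun t ht => ?_⟩
  set K := 2 * C / μ + 1 + |E r / h r| with hK
  have hK0 : 0 < K := by positivity
  have hKC : 2 * C < μ * K := by
    have : μ * K = 2 * C + μ * (1 + |E r / h r|) := by rw [hK]; field_simp; ring
    rw [this]
    have : 0 < μ * (1 + |E r / h r|) := by positivity
    linarith
  refine image_le_of_deriv_right_lt_deriv_boundary' (a := r) (b := t) (f' := E')
    (B := fun t => K * h t) (B' := fun t => K * h' t)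
    (fun y hy => (hE y hy.1).continuousAt.continuousWithinAt)
    (fun y hy => (hE y hy.1).hasDerivWithinAt) ?_
    (fun y hy => ((hh y hy.1).const_mul K).continuousAt.continuousWithinAt)
    (fun y hy => ((hh y hy.1).const_mul K).hasDerivWithinAt) ?_ (Set.right_mem_Icc.mpr ht)
  · have h1 : E r = E r / h r * h r := by field_simp [(hpos r le_rfl).ne']
    rw [h1]
    refine mul_le_mul_of_nonneg_right ?_ (hpos r le_rfl).le
    have : 0 ≤ 2 * C / μ := by positivity
    linarith [le_abs_self (E r / h r)]
  · intro y hy hEy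
    have h1 := hE' y hy.1
    have h2 := mul_le_mul_of_nonneg_left (hh' y hy.1) hK0.le
    have h3 : 0 < ρ y * h y := mul_pos (hρ y hy.1) (hpos y hy.1)
    have h4 := mul_lt_mul_of_pos_right hKC h3
    rw [hEy] at h1
    linarith

set_option maxHeartbeats 1000000 in
theorem exists_coefficient_bounds {q s γ k₁ k₂ : ℝ} (hq0 : 0 < q) (hq1 : q < 1) (hs : 0 < s)
    (hγ : 0 < γ) (hk₁ : 0 < k₁) (hk₂ : 0 < k₂) :
    ∃ C > 0, ∀ t T S m m' m'' : ℝ, 1 ≤ t → C ≤ t → 1 ≤ T → 1 ≤ S → 0 < m → γ ≤ m * T * S →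
      m * T ≤ k₁ → t * |m'| ≤ k₂ * m → t ^ 2 * |m''| ≤ k₂ * m →
      ∀ δ a a' β β' : ℝ, δ = T * S - γ * q * (T / t) →
      a = 1 - q * (m * (T / t)) - T * m' →
      a' = -(q * (m' * (T / t) + m * ((q - 1) * (T / t ^ 2)))) - (q * T / t * m' + T * m'') →
      β = T * (m * δ + a * γ) →
      β' = q * T / t * (m * δ + a * γ)
        + T * (m' * δ + m * ((q + s) * (T * S / t) - γ * q * ((q - 1) * (T / t ^ 2))) + a' * γ) →
      T * S / 2 ≤ δ ∧ 1 / 2 ≤ a ∧ a ≤ 2 ∧ a' ≤ C / t ^ 2 ∧ m * T ^ 2 * S / 2 ≤ β ∧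
        β ≤ 3 * (m * T ^ 2 * S) ∧ β' ≤ C * (T * S) / t := by
  set Ca := 4 * (q + k₂ + 1) * k₁ + 4 * k₂ * k₁ with hCa
  set Cb := q * k₁ + 2 * q * γ + k₂ * k₁ + k₁ * (q + s + γ * q) + Ca * γ with hCb
  have hCa0 : 0 < Ca := by positivity
  have hCb0 : 0 < Cb := by positivity
  refine ⟨Ca + Cb + 2 * γ * q + 2 * (q * k₁ + k₂ * k₁), by positivity, ?_⟩
  intro t T S m m' m'' ht1 hCt hT hS hm hγm hmk hm' hm'' δ a a' β β' hδ ha ha' hβ hβ'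
  have ht : 0 < t := by linarith
  have hT0 : 0 < T := by linarith
  have hS0 : 0 < S := by linarith
  have hTTS : T ≤ T * S := le_mul_of_one_le_right hT0.le hS
  have hM0 : 0 < m * T := by positivity
  set M₁ := T * (t * m') with hM₁
  set M₂ := T * (t ^ 2 * m'') with hM₂
  have hM₁b : |M₁| ≤ k₂ * k₁ := by
    rw [hM₁, abs_mul, abs_mul, abs_of_pos hT0, abs_of_pos ht]
    calc T * (t * |m'|) ≤ T * (k₂ * m) := by gcongr
      _ = k₂ * (m * T) := by ring
      _ ≤ _ := by gcongr
  have hM₂b : |M₂| ≤ k₂ * k₁ := by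
    rw [hM₂, abs_mul, abs_mul, abs_of_pos hT0, abs_of_pos (by positivity : 0 < t ^ 2)]
    calc T * (t ^ 2 * |m''|) ≤ T * (k₂ * m) := by gcongr
      _ = k₂ * (m * T) := by ring
      _ ≤ _ := by gcongr
  obtain ⟨h1l, h1u⟩ := abs_le.mp hM₁b
  obtain ⟨h2l, h2u⟩ := abs_le.mp hM₂b
  have hqM : q * (m * T) ≤ q * k₁ := by gcongr
  have hqM0 : 0 < q * (m * T) := by positivity
  have hkk : 0 < k₂ * k₁ := by positivity
  have hqk : 0 < q * k₁ := by positivity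
  have haeq : a = 1 - (q * (m * T) + M₁) / t := by rw [ha, hM₁]; field_simp; ring
  have haabs : |(q * (m * T) + M₁) / t| ≤ 1 / 2 := by
    rw [abs_div, abs_of_pos ht, div_le_iff₀ ht]
    refine (abs_le.mpr ⟨?_, ?_⟩ : |q * (m * T) + M₁| ≤ q * k₁ + k₂ * k₁).trans ?_
    · linarith
    · linarith
    · have : 0 < γ * q := by positivity
      linarith
  obtain ⟨ha1, ha2⟩ := abs_le.mp haabs
  have hδeq : δ = T * S - γ * q / t * T := by rw [hδ]; ring
  have hγt : γ * q / t ≤ 1 / 2 := by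
    rw [div_le_iff₀ ht]; linarith
  have hδl : T * S / 2 ≤ δ := by
    have : γ * q / t * T ≤ 1 / 2 * (T * S) := by gcongr
    linarith
  have hδu : δ ≤ T * S := by
    have : 0 ≤ γ * q / t * T := by positivity
    linarith
  have hδ0 : 0 < δ := lt_of_lt_of_le (by positivity) hδl
  have hal : 1 / 2 ≤ a := by linarith
  have hau : a ≤ 2 := by linarith
  have ha'eq : a' = -(2 * q * M₁ + q * (q - 1) * (m * T) + M₂) / t ^ 2 := by
    rw [ha', hM₁, hM₂]; field_simp; ring
  have ha'abs : |2 * q * M₁ + q * (q - 1) * (m * T) + M₂| ≤ Ca := by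
    have i1 : |2 * q * M₁| ≤ 2 * (k₂ * k₁) := by
      rw [abs_mul, abs_of_pos (by positivity : 0 < 2 * q)]
      gcongr
      linarith
    have i2 : |q * (q - 1) * (m * T)| ≤ 1 * k₁ := by
      rw [abs_mul, abs_of_pos hM0, abs_mul]
      gcongr
      refine mul_le_one₀ ?_ (abs_nonneg _) ?_ <;> rw [abs_le] <;> constructor <;> linarith
    refine (abs_add_three _ _ _).trans ?_
    have : 0 < q * k₁ := by positivity
    rw [hCa]
    linarith
  have ha'b : |a'| ≤ Ca / t ^ 2 := by
    rw [ha'eq, abs_div, abs_neg, abs_of_pos (by positivity : 0 < t ^ 2)]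
    gcongr
  refine ⟨hδl, hal, hau, (le_abs_self _).trans (ha'b.trans ?_), ?_, ?_, ?_⟩
  · gcongr
    have : 0 < γ * q := by positivity
    linarith
  · have i1 : T * (m * (T * S / 2)) ≤ T * (m * δ) := by gcongr
    have i2 : 0 ≤ T * (a * γ) := by positivity
    rw [hβ]
    linarith
  · have i1 : T * (m * δ) ≤ T * (m * (T * S)) := by gcongr
    have i2 : T * (a * γ) ≤ T * (2 * (m * T * S)) := by gcongr
    rw [hβ]
    linarith
  · have hβ'eq : β' = (q * (m * T) * δ + q * T * a * γ + M₁ * δ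
        + m * T * ((q + s) * (T * S) + γ * q * ((1 - q) * (T / t))) + T * (t * a') * γ) / t := by
      rw [hβ', hM₁]; field_simp; ring
    have j1 : q * (m * T) * δ ≤ q * k₁ * (T * S) :=
      mul_le_mul hqM hδu hδ0.le (by positivity)
    have j2 : q * T * a * γ ≤ q * (T * S) * 2 * γ := by gcongr
    have j3 : M₁ * δ ≤ k₂ * k₁ * (T * S) := by gcongr
    have j4 : m * T * ((q + s) * (T * S) + γ * q * ((1 - q) * (T / t)))
        ≤ k₁ * ((q + s) * (T * S) + γ * q * (1 * (T * S))) := by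
      have h1q : 0 ≤ 1 - q := by linarith
      gcongr
      · linarith
      · exact (div_le_self hT0.le ht1).trans hTTS
    have j0 : t * a' ≤ Ca := by
      calc t * a' ≤ t * (Ca / t ^ 2) := by
            gcongr
            exact (le_abs_self _).trans ha'b
        _ = Ca / t := by field_simp
        _ ≤ Ca := div_le_self hCa0.le ht1
    have j5 : T * (t * a') * γ ≤ T * S * Ca * γ := by
      calc T * (t * a') * γ ≤ T * Ca * γ := by gcongr
        _ ≤ T * S * Ca * γ := by gcongr
    rw [hβ'eq]
    refine div_le_div_of_nonneg_right ?_ ht.le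
    have j6 : 0 ≤ (Ca + 2 * γ * q + 2 * (q * k₁ + k₂ * k₁)) * (T * S) := by positivity
    rw [hCb]
    linarith

theorem hasDerivAt_rpow_const_div {t : ℝ} (ht : 0 < t) (q : ℝ) :
    HasDerivAt (fun r : ℝ => r ^ q) (q * t ^ q / t) t := by
  refine (Real.hasDerivAt_rpow_const (Or.inl ht.ne')).congr_deriv ?_
  rw [Real.rpow_sub_one ht.ne']
  ring

theorem hasDerivAt_rpow_div_self {t : ℝ} (ht : 0 < t) (q : ℝ) :
    HasDerivAt (fun r : ℝ => r ^ q / r) ((q - 1) * (t ^ q / t ^ 2)) t := by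
  refine ((hasDerivAt_rpow_const_div ht q).div (hasDerivAt_id t) ht.ne').congr_deriv ?_
  simp only [id]
  field_simp

theorem exists_hasDerivAt_and_le {E F h : ℝ → ℝ} {R : ℝ}
    (H : ∀ t ≥ R, ∃ e, HasDerivAt E e t ∧ e + F t ≤ h t) :
    ∃ E' : ℝ → ℝ, (∀ t ≥ R, HasDerivAt E (E' t) t) ∧ ∀ t ≥ R, E' t + F t ≤ h t := by
  choose! E' hE' using H
  exact ⟨E', fun t ht => (hE' t ht).1, fun t ht => (hE' t ht).2⟩

set_option maxHeartbeats 1000000 in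
theorem exists_primal_dual_bound
    {X Y : Type*} [NormedAddCommGroup X] [InnerProductSpace ℝ X] [CompleteSpace X]
    [NormedAddCommGroup Y] [InnerProductSpace ℝ Y] [CompleteSpace Y]
    {f : X → ℝ} {f' : X → X} (hf : ∀ u, HasGradientAt f (f' u) u)
    (hconv : ConvexOn ℝ Set.univ f) {A : X →L[ℝ] Y} {b : Y} {c p t₀ N : ℝ}
    (hc : 0 < c) (hp0 : 0 < p) (hN : 0 ≤ N)
    {α q γ s : ℝ} (hα : 1 < α) (hq0 : 0 < q) (hq1 : q < 1) (hγ : 0 < γ) (hs : 0 < s)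
    (hp2 : 2 * q + s ≤ p) (hp3 : p < (1 - q) / 2)
    {m m' m'' θ : ℝ → ℝ} (hmpos : ∀ t ≥ t₀, 0 < m t)
    (hmd : ∀ t ≥ t₀, HasDerivAt m (m' t) t) (hmd2 : ∀ t ≥ t₀, HasDerivAt m' (m'' t) t)
    (hθ : ∀ t, θ t = (m t * t ^ (2*q+s) + γ * t ^ q - 2 * m t * γ * q * t ^ (2*q-1)
      - γ * m' t * t ^ (2*q)) / ((α - 1) * (t ^ (q+s) - γ * q * t ^ (q-1))))
    {k₁ k₂ : ℝ} (hk₁ : 0 < k₁) (hk₂ : 0 < k₂)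
    (hA1 : ∀ᶠ t in atTop, γ / t ^ (q+s) ≤ m t ∧ m t ≤ k₁ / t ^ q)
    (hA2 : ∀ᶠ t in atTop, t * |m' t| ≤ k₂ * m t ∧ t ^ 2 * |m'' t| ≤ k₂ * m t)
    {x x' x'' gder G : ℝ → X} {lam lam' : ℝ → Y}
    (hG : ∀ t, G t = f' (x t) + ContinuousLinearMap.adjoint A (lam t) + (c / t ^ p) • x t)
    (hx : ∀ t ≥ t₀, HasDerivAt x (x' t) t) (hx' : ∀ t ≥ t₀, HasDerivAt x' (x'' t) t)
    (hlam : ∀ t ≥ t₀, HasDerivAt lam (lam' t) t) (hgder : ∀ t ≥ t₀, HasDerivAt G (gder t) t)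
    (hode1 : ∀ t ≥ t₀, m t • x'' t + (α / t ^ q) • x' t + γ • gder t + t ^ s • G t = 0)
    (hode2 : ∀ t ≥ t₀, lam' t = ((α - 1) * (t ^ (q+s) - γ * q * t ^ (q-1)))
      • (A (x t + θ t • x' t) - b - (c / t ^ p) • lam t))
    {xt xt' : ℝ → X} {lt lt' : ℝ → Y}
    (hsx : ∀ t ≥ t₀, f' (xt t) + ContinuousLinearMap.adjoint A (lt t) + (c / t ^ p) • xt t = 0)
    (hsl : ∀ t ≥ t₀, A (xt t) - b - (c / t ^ p) • lt t = 0)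
    (hxt : ∀ t ≥ t₀, HasDerivAt xt (xt' t) t) (hlt : ∀ t ≥ t₀, HasDerivAt lt (lt' t) t)
    (hbd : ∀ t ≥ t₀, ‖xt t‖ ^ 2 + ‖lt t‖ ^ 2 ≤ N ^ 2) :
    ∃ K > 0, ∀ᶠ t in atTop,
      |lagrangianGap f A (c / t ^ p) (x t) (xt t) (lt t)| ≤ K / t ^ p ∧
      ‖x t - xt t‖ ^ 2 + ‖lam t - lt t‖ ^ 2 ≤ K * (m t * t ^ q / t) ∧ m t * t ^ q / t ≤ k₁ := by
  have hν : 0 < α - 1 := by linarith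
  obtain ⟨μ, hμ, C, hC, hdis⟩ := exists_dissipation_bound (K := p * N) (B := ‖A‖ + c) hν hc hγ hk₁
    (by positivity) (by positivity)
  obtain ⟨Cc, hCc, hcoef⟩ := exists_coefficient_bounds hq0 hq1 hs hγ hk₁ hk₂
  obtain ⟨R, hR⟩ := eventually_atTop.mp (((((((hA1.and hA2).and (eventually_ge_atTop (1:ℝ))).and
    (eventually_gt_atTop t₀)).and (eventually_ge_atTop Cc)).and
    (eventually_ge_atTop (8 * Cc / c))).and (eventually_ge_atTop (8 * Cc / (α - 1)))).and
    (eventually_ge_atTop ((2 * (k₂ + 1) / μ) ^ 2)))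
  obtain ⟨δ, hδ⟩ : ∃ δ : ℝ → ℝ, ∀ t, δ t = t ^ q * t ^ s - γ * q * (t ^ q / t) := ⟨_, fun _ => rfl⟩
  obtain ⟨a, ha⟩ : ∃ a : ℝ → ℝ, ∀ t, a t = 1 - q * (m t * (t ^ q / t)) - t ^ q * m' t :=
    ⟨_, fun _ => rfl⟩
  obtain ⟨a', ha'⟩ : ∃ a' : ℝ → ℝ, ∀ t, a' t =
      -(q * (m' t * (t ^ q / t) + m t * ((q - 1) * (t ^ q / t ^ 2))))
        - (q * t ^ q / t * m' t + t ^ q * m'' t) := ⟨_, fun _ => rfl⟩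
  obtain ⟨β, hβ⟩ : ∃ β : ℝ → ℝ, ∀ t, β t = t ^ q * (m t * δ t + a t * γ) := ⟨_, fun _ => rfl⟩
  obtain ⟨β', hβ'⟩ : ∃ β' : ℝ → ℝ, ∀ t, β' t = q * t ^ q / t * (m t * δ t + a t * γ)
      + t ^ q * (m' t * δ t + m t * ((q + s) * (t ^ q * t ^ s / t)
        - γ * q * ((q - 1) * (t ^ q / t ^ 2))) + a' t * γ) := ⟨_, fun _ => rfl⟩
  have hscal : ∀ t ≥ R, (t₀ < t ∧ 0 < t ∧ 1 ≤ t ^ q ∧ 1 ≤ t ^ s ∧ 1 ≤ t ^ p ∧ 0 < m t) ∧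
      (t ^ q) ^ 2 * t ^ s ≤ t ^ p ∧ (t ^ p) ^ 2 ≤ t ∧ γ ≤ m t * t ^ q * t ^ s ∧ m t * t ^ q ≤ k₁ ∧
      (t ^ q * t ^ s / 2 ≤ δ t ∧ 1 / 2 ≤ a t ∧ a t ≤ 2 ∧ m t * (t ^ q) ^ 2 * t ^ s / 2 ≤ β t ∧
        β t ≤ 3 * (m t * (t ^ q) ^ 2 * t ^ s)) ∧ β' t ≤ (α - 1) / 8 * (t ^ q * t ^ s) ∧
      a' t ≤ c / 8 * (t ^ q * t ^ s / t ^ p) ∧ (k₂ + 1) / t ≤ μ / 2 * (t ^ q * t ^ s / t ^ p) ∧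
      t * |m' t| ≤ k₂ * m t ∧ t ^ p ≤ t ∧ 1 ≤ t := by
    intro t ht
    obtain ⟨⟨⟨⟨⟨⟨⟨⟨hm1, hm2⟩, hm3, hm4⟩, ht1⟩, htt₀⟩, htC⟩, htc⟩, htν⟩, htμ⟩ := hR t ht
    have ht0 : 0 < t := by linarith
    have hT := Real.one_le_rpow ht1 hq0.le
    have hS := Real.one_le_rpow ht1 hs.le
    have hP := Real.one_le_rpow ht1 hp0.le
    have hT0 : 0 < t ^ q := by linarith
    have hS0 : 0 < t ^ s := by linarith
    have hP0 : 0 < t ^ p := by linarith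
    have hmt := hmpos t htt₀.le
    have h1 : (t ^ q) ^ 2 * t ^ s ≤ t ^ p := by
      rw [← Real.rpow_mul_natCast ht0.le, ← Real.rpow_add ht0]
      refine Real.rpow_le_rpow_of_exponent_le ht1 ?_
      push_cast; linarith
    have h2 : (t ^ p) ^ 2 ≤ t := by
      rw [← Real.rpow_mul_natCast ht0.le]
      refine (Real.rpow_le_rpow_of_exponent_le ht1 ?_).trans (Real.rpow_one t).le
      push_cast; linarith
    have h3 : γ ≤ m t * t ^ q * t ^ s := by
      rw [div_le_iff₀ (by positivity), Real.rpow_add ht0] at hm1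
      linarith
    have h4 : m t * t ^ q ≤ k₁ := (le_div_iff₀ hT0).mp hm2
    obtain ⟨c1, c2, c3, c4, c5, c6, c7⟩ := hcoef t (t ^ q) (t ^ s) (m t) (m' t) (m'' t) ht1 htC hT
      hS hmt h3 h4 hm3 hm4 (δ t) (a t) (a' t) (β t) (β' t) (hδ t) (ha t) (ha' t) (hβ t) (hβ' t)
    have hTS : 1 ≤ t ^ q * t ^ s := one_le_mul_of_one_le_of_one_le hT hS
    have hPt : t ^ p ≤ t := (le_self_pow₀ hP two_ne_zero).trans h2
    have hPinv : 1 / t ≤ t ^ q * t ^ s / t ^ p := by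
      rw [div_le_div_iff₀ ht0 hP0]
      nlinarith
    refine ⟨⟨htt₀, ht0, hT, hS, hP, hmt⟩, h1, h2, h3, h4, ⟨c1, c2, c3, c5, c6⟩, ?_, ?_, ?_, hm3,
      hPt, ht1⟩
    · refine c7.trans ?_
      rw [div_le_iff₀ ht0]
      have : Cc ≤ (α - 1) / 8 * t := by
        rw [div_le_iff₀ hν] at htν; linarith
      calc Cc * (t ^ q * t ^ s) ≤ (α - 1) / 8 * t * (t ^ q * t ^ s) := by gcongr
        _ = _ := by ring
    · refine c4.trans ?_
      have : Cc / t ≤ c / 8 := by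
        rw [div_le_iff₀ hc] at htc
        rw [div_le_iff₀ ht0]; linarith
      calc Cc / t ^ 2 = Cc / t * (1 / t) := by field_simp
        _ ≤ c / 8 * (t ^ q * t ^ s / t ^ p) := by gcongr
    · have h5 : 2 * (k₂ + 1) / μ * t ^ p ≤ t := by
        refine le_of_sq_le_sq ?_ ht0.le
        calc (2 * (k₂ + 1) / μ * t ^ p) ^ 2 = (2 * (k₂ + 1) / μ) ^ 2 * (t ^ p) ^ 2 := by ring
          _ ≤ t * t := by gcongr
          _ = t ^ 2 := by ring
      calc (k₂ + 1) / t = μ / 2 * (2 * (k₂ + 1) / μ * t ^ p / t) * (1 / t ^ p) := by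
            field_simp
        _ ≤ μ / 2 * 1 * (t ^ q * t ^ s / t ^ p) := by
            gcongr
            rwa [div_le_one ht0]
        _ = _ := by ring
  have hgrad : ∀ u y, f u + ⟪f' u, y - u⟫ ≤ f y := fun u y =>
    hconv.add_inner_le_of_hasGradientAt (hf u) y
  have hκd : ∀ t > 0, HasDerivAt (fun r => c / r ^ p) (-(c / t ^ p * p / t)) t := by
    intro t ht
    have hP0 := Real.rpow_pos_of_pos ht p
    refine ((hasDerivAt_const t c).div (hasDerivAt_rpow_const_div ht p) hP0.ne').congr_deriv ?_
    field_simp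
    ring
  have hspeed : ∀ t ≥ R, ‖xt' t‖ ≤ p * N / t ∧ ‖lt' t‖ ≤ p * N / t := by
    intro t ht
    obtain ⟨⟨htt₀, ht0, -, -, hP, -⟩, -⟩ := hscal t ht
    have hP0 : 0 < t ^ p := by linarith
    have hnhds : ∀ᶠ r in 𝓝 t, t₀ ≤ r := Ici_mem_nhds htt₀
    have h1 := sq_norm_deriv_regularized_saddle_le hf hconv (ε := fun r => c / r ^ p)
      (by positivity) (hnhds.mono fun r hr => hsx r hr) (hnhds.mono fun r hr => hsl r hr)
      (hnhds.mono fun r hr => hbd r hr) (hxt t htt₀.le) (hlt t htt₀.le) (hκd t ht0)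
    have h2 : ‖xt' t‖ ^ 2 + ‖lt' t‖ ^ 2 ≤ (p * N / t) ^ 2 := by
      have h3 : (-(c / t ^ p * p / t)) ^ 2 * N ^ 2 = (c / t ^ p) ^ 2 * (p * N / t) ^ 2 := by ring
      rw [h3] at h1
      exact le_of_mul_le_mul_left h1 (by positivity)
    have h4 : 0 ≤ p * N / t := by positivity
    exact ⟨le_of_sq_le_sq (by linarith [sq_nonneg ‖lt' t‖]) h4,
      le_of_sq_le_sq (by linarith [sq_nonneg ‖xt' t‖]) h4⟩
  set E := lyapunovEnergy f A (α - 1) γ β (fun t => c / t ^ p) a m (fun t => t ^ q) x x' G xt lam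
    lt with hE
  have hEnergy : ∃ E' : ℝ → ℝ, (∀ t ≥ R, HasDerivAt E (E' t) t) ∧
      ∀ t ≥ R, E' t + μ * (t ^ q * t ^ s / t ^ p) * E t
        ≤ C * (t ^ q * t ^ s / t ^ p) * (m t * t ^ q / t) := by
    refine exists_hasDerivAt_and_le fun t ht => ?_
    obtain ⟨⟨htt₀, ht0, hT, hS, hP, hmt⟩, hTP, hPt, hγm, hmk, ⟨d1, d2, d3, d4, d5⟩, d6, d7, -⟩ :=
      hscal t ht
    obtain ⟨hz, hζ⟩ := hspeed t ht
    have htle := htt₀.le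
    have hT0 : 0 < t ^ q := by linarith
    have hS0 : 0 < t ^ s := by linarith
    have hP0 : 0 < t ^ p := by linarith
    have hδ0 : 0 < δ t := lt_of_lt_of_le (by positivity) d1
    have hβ0 : 0 ≤ β t := le_trans (by positivity) d4
    have hκ0 : 0 ≤ c / t ^ p := by positivity
    have hTd := hasDerivAt_rpow_const_div ht0 q
    have hTd2 := hasDerivAt_rpow_div_self ht0 q
    have hδd : HasDerivAt δ ((q + s) * (t ^ q * t ^ s / t)
        - γ * q * ((q - 1) * (t ^ q / t ^ 2))) t := by
      rw [funext hδ]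
      refine ((hTd.mul (hasDerivAt_rpow_const_div ht0 s)).sub
        (hTd2.const_mul (γ * q))).congr_deriv ?_
      ring
    have had : HasDerivAt a (a' t) t := by
      rw [funext ha]
      refine ((((hmd t htle).mul hTd2).const_mul q).const_sub 1 |>.sub
        (hTd.mul (hmd2 t htle))).congr_deriv ?_
      rw [ha']
    have hβd : HasDerivAt β (β' t) t := by
      rw [funext hβ]
      refine (hTd.mul (((hmd t htle).mul hδd).add (had.mul_const γ))).congr_deriv ?_
      rw [hβ']
      simp only [Pi.add_apply, Pi.mul_apply]
    have hv : (α - 1) • (x' t - xt' t) + ((q * t ^ q / t) • (m t • x' t + γ • G t)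
        + t ^ q • (m' t • x' t + m t • x'' t + γ • gder t))
        = -(a t • x' t) - δ t • G t - (α - 1) • xt' t := by
      have h1 := congrArg (fun v => t ^ q • v) (hode1 t htle)
      simp only [smul_add, smul_smul, smul_zero] at h1
      rw [mul_div_cancel₀ _ hT0.ne'] at h1
      rw [ha, hδ]
      rw [← sub_eq_zero, ← h1]
      match_scalars <;> ring
    have hGe : G t = (f' (x t) + ContinuousLinearMap.adjoint A (lt t) + (c / t ^ p) • x t)
        + ContinuousLinearMap.adjoint A (lam t - lt t) := by
      rw [hG, map_sub]
      abel
    have hlam'e : lam' t = ((α - 1) * δ t) • (A (x t - xt t) - (c / t ^ p) • (lam t - lt t))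
        + β t • A (x' t) := by
      have e1 : t ^ (q + s) - γ * q * t ^ (q - 1) = δ t := by
        rw [hδ, Real.rpow_add ht0, Real.rpow_sub_one ht0.ne']
      have e2 : (α - 1) * δ t * θ t = β t := by
        rw [hθ, e1, mul_div_cancel₀ _ (by positivity), hβ, hδ, ha, Real.rpow_add ht0,
          Real.rpow_sub_one ht0.ne', two_mul, Real.rpow_add ht0]
        ring
      rw [hode2 t htle, e1, ← e2, ← sub_zero (A (x t + θ t • x' t) - b - (c / t ^ p) • lam t),
        ← hsl t htle]
      simp only [map_add, map_sub, map_smul]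
      module
    have hder := hasDerivAt_lyapunovEnergy hf hβd (hκd t ht0) had (hmd t htle) hTd (hx t htle)
      (hx' t htle) (hgder t htle) (hxt t htle) (hlam t htle) (hlt t htle) (hsx t htle) hv
    refine ⟨_, hder, ?_⟩
    have hxtN : ‖xt t‖ ≤ N :=
      le_of_sq_le_sq ((le_add_of_nonneg_right (sq_nonneg _)).trans (hbd t htle)) hN
    have hσ : -(c / t ^ p * p / t) / 2 * (‖x t‖ ^ 2 - ‖xt t‖ ^ 2)
        ≤ c * (p * N / t) * ‖x t - xt t‖ := by
      have h1 : ‖xt t‖ - ‖x t‖ ≤ ‖x t - xt t‖ := by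
        rw [← norm_neg (x t - xt t), neg_sub]; exact norm_sub_norm_le _ _
      have h2 : ‖xt t‖ ^ 2 - ‖x t‖ ^ 2 ≤ 2 * N * ‖x t - xt t‖ := by
        have h3 : ‖xt t‖ ^ 2 - ‖x t‖ ^ 2 ≤ 2 * ‖xt t‖ * ‖x t - xt t‖ := by
          linarith [mul_le_mul_of_nonneg_left h1 (norm_nonneg (xt t)), sq_nonneg (‖xt t‖ - ‖x t‖)]
        refine h3.trans ?_
        gcongr
      calc -(c / t ^ p * p / t) / 2 * (‖x t‖ ^ 2 - ‖xt t‖ ^ 2)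
          = c * p / t / 2 * (1 / t ^ p) * (‖xt t‖ ^ 2 - ‖x t‖ ^ 2) := by ring
        _ ≤ c * p / t / 2 * (1 / t ^ p) * (2 * N * ‖x t - xt t‖) := by gcongr
        _ ≤ c * p / t / 2 * 1 * (2 * N * ‖x t - xt t‖) := by
            gcongr
            rwa [div_le_one hP0]
        _ = _ := by ring
    refine hdis t (t ^ q) (t ^ s) (t ^ p) (m t) (δ t) (β t) (β' t) (a t) (a' t) ‖x t - xt t‖
      ‖lam t - lt t‖ ‖x' t‖ ‖G t‖ (lagrangianGap f A (c / t ^ p) (x t) (xt t) (lt t)) _ _ ht0 hT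
      hS hP hmt hTP hPt hγm hmk d1 d2 d3 hβ0 d5 d6 d7 (norm_nonneg _) (norm_nonneg _)
      (le_trans (by positivity) (le_lagrangianGap (hgrad _) (hsx t htle))) ?_ ?_
    · rw [lyapunovEnergy_deriv_eq hGe (hβ t) hlam'e]
      refine (lyapunovEnergy_deriv_le hν.le hγ.le hδ0.le hβ0 (by linarith) hmt.le hT0.le hz hζ hσ
        (lagrangianGap_add_le (hgrad _))).trans (le_of_eq ?_)
      ring
    · rw [hE, lyapunovEnergy]
      have := sq_norm_smul_add_le (e := x t - xt t) (w := x' t) (G := G t) (ν := α - 1) (γ := γ)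
        (m := m t) (T := t ^ q)
      linarith
  obtain ⟨E', hE1, hE2⟩ := hEnergy
  obtain ⟨K, hK, hEK⟩ := exists_le_const_mul_of_deriv_le (h := fun t => m t * t ^ q / t)
    (h' := fun t => m' t * (t ^ q / t) + m t * ((q - 1) * (t ^ q / t ^ 2)))
    (ρ := fun t => t ^ q * t ^ s / t ^ p) hμ hC hE1
    (fun t ht => by
      obtain ⟨⟨htt₀, ht0, -⟩, -⟩ := hscal t ht
      simp only [mul_div_assoc]
      exact (hmd t htt₀.le).mul (hasDerivAt_rpow_div_self ht0 q))
    (fun t ht => by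
      obtain ⟨⟨-, ht0, -, -, -, hmt⟩, -⟩ := hscal t ht
      positivity)
    (fun t ht => by
      obtain ⟨⟨-, ht0, -⟩, -⟩ := hscal t ht
      positivity)
    hE2
    (fun t ht => by
      obtain ⟨⟨-, ht0, hT, hS, hP, hmt⟩, -, -, -, -, -, -, -, h8, h9, -⟩ := hscal t ht
      have hT0 : 0 < t ^ q := by linarith
      have h1 := mul_le_mul_of_nonneg_right h8 (by positivity : 0 ≤ m t * t ^ q / t)
      have h2 : -(k₂ * m t) ≤ t * m' t := by
        have := mul_le_mul_of_nonneg_left (neg_abs_le (m' t)) ht0.le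
        linarith
      have h3 := mul_le_mul_of_nonneg_right h2 (by positivity : 0 ≤ t ^ q / t ^ 2)
      have h4 : 0 ≤ q * (m t * (t ^ q / t ^ 2)) := by positivity
      have h5 : t * m' t * (t ^ q / t ^ 2) = m' t * (t ^ q / t) := by field_simp
      have h6 : (k₂ + 1) / t * (m t * t ^ q / t) = (k₂ + 1) * m t * (t ^ q / t ^ 2) := by
        field_simp
      rw [h5] at h3
      rw [h6] at h1
      linarith)
  refine ⟨(4 / (α - 1) + 4) * K, by positivity, ?_⟩
  filter_upwards [eventually_ge_atTop R] with t ht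
  obtain ⟨⟨htt₀, ht0, hT, hS, hP, hmt⟩, -, -, -, hmk, ⟨-, d2, -, d4, -⟩, -, -, -, -, hPt, ht1⟩ :=
    hscal t ht
  have hT0 : 0 < t ^ q := by linarith
  have hP0 : 0 < t ^ p := by linarith
  have hle := hEK t ht
  beta_reduce at hle
  rw [hE, lyapunovEnergy] at hle
  have hgap : 0 ≤ lagrangianGap f A (c / t ^ p) (x t) (xt t) (lt t) :=
    le_trans (by positivity) (le_lagrangianGap (hgrad _) (hsx t htt₀.le))
  set Δ := lagrangianGap f A (c / t ^ p) (x t) (xt t) (lt t)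
  have hβΔ := mul_le_mul_of_nonneg_right d4 hgap
  have hβΔ0 : 0 ≤ m t * (t ^ q) ^ 2 * t ^ s / 2 * Δ := by positivity
  have hae := mul_le_mul_of_nonneg_right d2 (sq_nonneg ‖x t - xt t‖)
  have hνae := mul_le_mul_of_nonneg_left hae hν.le
  have hvel := sq_nonneg ‖(α - 1) • (x t - xt t) + t ^ q • (m t • x' t + γ • G t)‖
  have hmTt : 0 < m t * t ^ q / t := by positivity
  have hν4 : 0 < 4 / (α - 1) := by positivity
  refine ⟨?_, ?_, ?_⟩
  · rw [abs_of_nonneg hgap]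
    have h1 : m t * t ^ q * (Δ / 2) ≤ m t * t ^ q * (K / t) := by
      calc m t * t ^ q * (Δ / 2) ≤ m t * t ^ q * (Δ / 2) * (t ^ q * t ^ s) :=
            le_mul_of_one_le_right (by positivity) (one_le_mul_of_one_le_of_one_le hT hS)
        _ = m t * (t ^ q) ^ 2 * t ^ s / 2 * Δ := by ring
        _ ≤ K * (m t * t ^ q / t) := by
            linarith [sq_nonneg ‖lam t - lt t‖,
              mul_nonneg hν.le (sq_nonneg ‖x t - xt t‖)]
        _ = _ := by ring
    have h2 : Δ / 2 ≤ K / t := le_of_mul_le_mul_left h1 (by positivity)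
    calc Δ ≤ 2 * (K / t) := by linarith
      _ ≤ 2 * (K / t ^ p) := by gcongr
      _ = 2 * K / t ^ p := by ring
      _ ≤ (4 / (α - 1) + 4) * K / t ^ p := by gcongr; linarith
  · have h1 : (α - 1) / 4 * ‖x t - xt t‖ ^ 2 + 1 / 2 * ‖lam t - lt t‖ ^ 2
        ≤ K * (m t * t ^ q / t) := by linarith
    have h2 : (α - 1) * ‖x t - xt t‖ ^ 2 ≤ 4 * (K * (m t * t ^ q / t)) := by
      linarith [sq_nonneg ‖lam t - lt t‖]
    have h3 : ‖x t - xt t‖ ^ 2 ≤ 4 * (K * (m t * t ^ q / t)) / (α - 1) := by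
      rw [le_div_iff₀ hν]; linarith
    have h4 : 0 ≤ (α - 1) * ‖x t - xt t‖ ^ 2 := by positivity
    have h5 : 0 < K * (m t * t ^ q / t) := by positivity
    calc ‖x t - xt t‖ ^ 2 + ‖lam t - lt t‖ ^ 2
        ≤ 4 * (K * (m t * t ^ q / t)) / (α - 1) + 4 * (K * (m t * t ^ q / t)) := by linarith
      _ = _ := by ring
  · exact (div_le_self (by positivity) ht1).trans hmk


theorem rates_small_p_subcase_two
    {X Y : Type*} [NormedAddCommGroup X] [InnerProductSpace ℝ X] [CompleteSpace X]
    [NormedAddCommGroup Y] [InnerProductSpace ℝ Y] [CompleteSpace Y]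
    (f : X → ℝ) (f' : X → X) (hf : ∀ u, HasGradientAt f (f' u) u)
    (hconv : ConvexOn ℝ Set.univ f)
    (A : X →L[ℝ] Y) (b : Y)
    (L : X → Y → ℝ) (hL : ∀ u lam, L u lam = f u + ⟪lam, A u - b⟫)
    (c p t₀ : ℝ) (hc : 0 < c) (hp0 : 0 < p) (hp1 : p < 1) (ht₀ : 0 < t₀)
    (Lt : ℝ → X → Y → ℝ)
    (hLt : ∀ t u lam, Lt t u lam = L u lam + (c / (2 * t ^ p)) * (‖u‖ ^ 2 - ‖lam‖ ^ 2))
    (gx : ℝ → X → Y → X)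
    (hgx : ∀ t u lam, gx t u lam = f' u + ContinuousLinearMap.adjoint A lam + (c / t ^ p) • u)
    (gl : ℝ → X → Y → Y)
    (hgl : ∀ t u lam, gl t u lam = A u - b - (c / t ^ p) • lam)
    (Om : Set (X × Y))
    (hOm : Om = {z : X × Y | ∀ u μ, L z.1 μ ≤ L z.1 z.2 ∧ L z.1 z.2 ≤ L u z.2})
    (hOmne : Om.Nonempty)
    (xs : X) (ls : Y)
    (hmem : (xs, ls) ∈ Om)
    (hmin : ∀ w ∈ Om, Real.sqrt (‖xs‖ ^ 2 + ‖ls‖ ^ 2) ≤ Real.sqrt (‖w.1‖ ^ 2 + ‖w.2‖ ^ 2))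
    (α q γ s : ℝ) (hα : 1 < α) (hq0 : 0 < q) (hq1 : q < 1) (hγ : 0 < γ) (hs : 0 < s)
    (m m' m'' : ℝ → ℝ)
    (hmpos : ∀ t ≥ t₀, 0 < m t)
    (hmmono : AntitoneOn m (Set.Ici t₀))
    (hmd : ∀ t ≥ t₀, HasDerivAt m (m' t) t)
    (hmd2 : ∀ t ≥ t₀, HasDerivAt m' (m'' t) t)
    (θ : ℝ → ℝ)
    (hθ : ∀ t, θ t = (m t * t ^ (2*q+s) + γ * t ^ q - 2 * m t * γ * q * t ^ (2*q-1)
      - γ * m' t * t ^ (2*q)) / ((α - 1) * (t ^ (q+s) - γ * q * t ^ (q-1))))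
    (k₁ k₂ T₁ T₂ : ℝ) (hk₁ : 0 < k₁) (hk₂ : 0 < k₂) (hT₁ : t₀ ≤ T₁) (hT₂ : t₀ ≤ T₂)
    (hA1 : ∀ t ≥ T₁, γ / t ^ (q+s) ≤ m t ∧ m t ≤ k₁ / t ^ q)
    (hA2 : ∀ t ≥ T₂, t * |m' t| ≤ k₂ * m t ∧ t ^ 2 * |m'' t| ≤ k₂ * m t)
    (x : ℝ → X) (lam : ℝ → Y) (x' x'' : ℝ → X) (lam' : ℝ → Y) (gder : ℝ → X)
    (hx : ∀ t ≥ t₀, HasDerivAt x (x' t) t)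
    (hx' : ∀ t ≥ t₀, HasDerivAt x' (x'' t) t)
    (hx''c : ContinuousOn x'' (Set.Ici t₀))
    (hlam : ∀ t ≥ t₀, HasDerivAt lam (lam' t) t)
    (hlamc : ContinuousOn lam' (Set.Ici t₀))
    (hgder : ∀ t ≥ t₀, HasDerivAt (fun τ => gx τ (x τ) (lam τ)) (gder t) t)
    (hode1 : ∀ t ≥ t₀, m t • x'' t + (α / t ^ q) • x' t + γ • gder t
      + t ^ s • gx t (x t) (lam t) = 0)
    (hode2 : ∀ t ≥ t₀, lam' t = ((α - 1) * (t ^ (q+s) - γ * q * t ^ (q-1)))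
      • gl t (x t + θ t • x' t) (lam t))
    (xt : ℝ → X) (lt : ℝ → Y)
    (hsaddle : ∀ t ≥ t₀, gx t (xt t) (lt t) = 0 ∧ gl t (xt t) (lt t) = 0)
    (xt' : ℝ → X) (lt' : ℝ → Y)
    (hxt : ∀ t ≥ t₀, HasDerivAt xt (xt' t) t)
    (hlt : ∀ t ≥ t₀, HasDerivAt lt (lt' t) t)
    (hxtc : ContinuousOn xt' (Set.Ici t₀))
    (hltc : ContinuousOn lt' (Set.Ici t₀))
    (hcond1 : 5*q + 2*s - 1 < 0) (hcond2 : 4*q + s + p - 2 < 0)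
    (hp2 : 2*q + s ≤ p) (hp3 : p < (1 - q)/2)
    :
    ((fun t => L (x t) ls - L xs ls) =O[atTop]
        (fun t => Real.sqrt (m t) * t ^ ((q-1)/2) + t ^ (-p)))
    ∧ ((fun t => |f (x t) - f xs|) =O[atTop]
        (fun t => Real.sqrt (m t) * t ^ ((q-1)/2) + t ^ (-p)))
    ∧ ((fun t => ‖A (x t) - b‖) =O[atTop]
        (fun t => Real.sqrt (m t) * t ^ ((q-1)/2) + t ^ (-p)))
    ∧ ((fun t => ‖x t - xt t‖ ^ 2 + ‖lam t - lt t‖ ^ 2) =O[atTop]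
        (fun t => m t * t ^ (q-1))) := by
  have hsad : ∀ u μ, L xs μ ≤ L xs ls ∧ L xs ls ≤ L u ls := by
    have h := hmem
    rw [hOm] at h
    exact h
  have hfeas : A xs = b := by
    have h := (hsad xs (ls + (A xs - b))).1
    rw [hL, hL, inner_add_left, real_inner_self_eq_norm_sq] at h
    have h1 : ‖A xs - b‖ ^ 2 ≤ 0 := by linarith
    rw [← sub_eq_zero, ← norm_eq_zero]
    exact pow_eq_zero_iff two_ne_zero |>.mp (le_antisymm h1 (sq_nonneg _))
  have hopt : ∀ u, f xs ≤ f u + ⟪ls, A u - b⟫ := by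
    intro u
    have h := (hsad u ls).2
    rwa [hL, hL, hfeas, sub_self, inner_zero_right, add_zero] at h
  simp only [hgx, hgl] at hgder hode1 hode2 hsaddle
  set N := √(‖xs‖ ^ 2 + ‖ls‖ ^ 2) with hNdef
  have hN2 : N ^ 2 = ‖xs‖ ^ 2 + ‖ls‖ ^ 2 := Real.sq_sqrt (by positivity)
  have hN : 0 ≤ N := Real.sqrt_nonneg _
  have hbd : ∀ t ≥ t₀, ‖xt t‖ ^ 2 + ‖lt t‖ ^ 2 ≤ N ^ 2 := by
    intro t ht
    have ht0 : 0 < t := by linarith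
    rw [hN2]
    exact sq_norm_regularized_saddle_le hconv (ε := c / t ^ p) (by positivity) (hf _) hfeas hopt
      (hsaddle t ht).1 (hsaddle t ht).2
  obtain ⟨K, hK, hbound⟩ := exists_primal_dual_bound hf hconv hc hp0 hN hα hq0 hq1 hγ hs hp2
    hp3 hmpos hmd hmd2 hθ hk₁ hk₂ ((eventually_ge_atTop T₁).mono hA1)
    ((eventually_ge_atTop T₂).mono hA2) (fun _ => rfl) hx hx' hlam hgder hode1 hode2
    (fun t ht => (hsaddle t ht).1) (fun t ht => (hsaddle t ht).2) hxt hlt hbd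
  have hxsN : ‖xs‖ ≤ N := le_of_sq_le_sq (by linarith [sq_nonneg ‖ls‖]) hN
  have hlsN : ‖ls‖ ≤ N := le_of_sq_le_sq (by linarith [sq_nonneg ‖xs‖]) hN
  obtain ⟨Ψ, hΨ⟩ : ∃ Ψ : ℝ → ℝ, ∀ t, Ψ t = √(m t) * t ^ ((q-1)/2) + t ^ (-p) := ⟨_, fun _ => rfl⟩
  simp only [← hΨ]
  have key : ∀ᶠ t in atTop, 0 ≤ Ψ t ∧
      ‖A (x t) - b‖ ≤ (‖A‖ * √K + c * N) * Ψ t ∧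
      |f (x t) - f xs| ≤ (K + N * (‖A‖ * √K) + c * (2 * N ^ 2 + (2 * N ^ 2 + 2 * (K * k₁)))) * Ψ t ∧
      ‖x t - xt t‖ ^ 2 + ‖lam t - lt t‖ ^ 2 ≤ K * (m t * t ^ (q-1)) ∧ 0 ≤ m t * t ^ (q-1) := by
    filter_upwards [hbound, eventually_ge_atTop t₀] with t ⟨hgap, hdist, hk⟩ ht
    have ht0 : 0 < t := by linarith
    have hmt := hmpos t ht
    have hP0 := Real.rpow_pos_of_pos ht0 p
    have hPn : t ^ (-p) = 1 / t ^ p := by rw [Real.rpow_neg ht0.le, one_div]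
    have hmq : m t * t ^ q / t = m t * t ^ (q-1) := by
      rw [Real.rpow_sub_one ht0.ne', mul_div_assoc]
    have hmq0 : 0 < m t * t ^ (q-1) := by positivity
    have hsqrt : √(m t * t ^ (q-1)) = √(m t) * t ^ ((q-1)/2) := by
      rw [Real.sqrt_mul hmt.le, Real.sqrt_eq_rpow (t ^ (q-1)), ← Real.rpow_mul ht0.le]
      ring_nf
    rw [hmq] at hdist hk
    have hdx : ‖x t - xt t‖ ^ 2 ≤ K * (m t * t ^ (q-1)) := by
      linarith [sq_nonneg ‖lam t - lt t‖]
    have hdx' : ‖x t - xt t‖ ≤ √K * (√(m t) * t ^ ((q-1)/2)) := by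
      rw [← hsqrt, ← Real.sqrt_mul hK.le]
      exact Real.le_sqrt_of_sq_le hdx
    have hΨ1 : √(m t) * t ^ ((q-1)/2) ≤ Ψ t := by
      rw [hΨ]; linarith [Real.rpow_pos_of_pos ht0 (-p)]
    have hΨ2 : 1 / t ^ p ≤ Ψ t := by
      rw [hΨ, ← hPn]
      exact le_add_of_nonneg_left (by positivity)
    have hΨ0 : 0 ≤ Ψ t := le_trans (by positivity) hΨ2
    have hxtN : ‖xt t‖ ≤ N := le_of_sq_le_sq (by linarith [hbd t ht, sq_nonneg ‖lt t‖]) hN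
    have hltN : ‖lt t‖ ≤ N := le_of_sq_le_sq (by linarith [hbd t ht, sq_nonneg ‖xt t‖]) hN
    have hdΨ : ‖x t - xt t‖ ≤ √K * Ψ t :=
      hdx'.trans (mul_le_mul_of_nonneg_left hΨ1 (Real.sqrt_nonneg _))
    have hκΨ : c / t ^ p ≤ c * Ψ t := by
      rw [div_eq_mul_one_div]; gcongr
    obtain ⟨hs1, hs2⟩ := hsaddle t ht
    refine ⟨hΨ0, ?_, ?_, hdist, hmq0.le⟩
    · have h1 : A (x t) - b = A (x t - xt t) + (c / t ^ p) • lt t := by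
        rw [← sub_zero (A (x t) - b), ← hs2, map_sub]
        abel
      calc ‖A (x t) - b‖ ≤ ‖A (x t - xt t)‖ + ‖(c / t ^ p) • lt t‖ := by
            rw [h1]; exact norm_add_le _ _
        _ ≤ ‖A‖ * ‖x t - xt t‖ + c / t ^ p * ‖lt t‖ := by
            rw [norm_smul, Real.norm_of_nonneg (by positivity)]
            gcongr
            exact A.le_opNorm _
        _ ≤ ‖A‖ * (√K * Ψ t) + c * Ψ t * N := by gcongr
        _ = _ := by ring
    · have h1 := abs_sub_le_lagrangianGap_add (u := x t) (N := N) (by positivity : 0 ≤ c / t ^ p)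
        (fun y => hconv.add_inner_le_of_hasGradientAt (hf _) y) hs1 hs2 hfeas hopt hxtN hltN
        hxsN hlsN
      have h2 : ‖x t‖ ^ 2 ≤ 2 * N ^ 2 + 2 * (K * k₁) := by
        have h3 : ‖x t‖ ≤ ‖xt t‖ + ‖x t - xt t‖ := by
          have := norm_add_le (xt t) (x t - xt t)
          rwa [add_sub_cancel] at this
        have h4 : ‖x t - xt t‖ ^ 2 ≤ K * k₁ := hdx.trans (by gcongr)
        have h5 := pow_le_pow_left₀ (norm_nonneg _) h3 2
        have h6 := pow_le_pow_left₀ (norm_nonneg _) hxtN 2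
        linarith [sq_nonneg (‖xt t‖ - ‖x t - xt t‖)]
      calc |f (x t) - f xs|
          ≤ |lagrangianGap f A (c / t ^ p) (x t) (xt t) (lt t)| + N * (‖A‖ * ‖x t - xt t‖)
            + c / t ^ p * (2 * N ^ 2 + ‖x t‖ ^ 2) := h1
        _ ≤ K * Ψ t + N * (‖A‖ * (√K * Ψ t))
            + c * Ψ t * (2 * N ^ 2 + (2 * N ^ 2 + 2 * (K * k₁))) := by
            gcongr
            refine hgap.trans ?_
            rw [div_eq_mul_one_div]
            gcongr
        _ = _ := by ring
  have hO1 : (fun t => f (x t) - f xs) =O[atTop] Ψ := by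
    refine IsBigO.of_bound (K + N * (‖A‖ * √K) + c * (2 * N ^ 2 + (2 * N ^ 2 + 2 * (K * k₁))))
      (key.mono fun t ht => ?_)
    rw [Real.norm_eq_abs, Real.norm_of_nonneg ht.1]
    exact ht.2.2.1
  have hO2 : (fun t => A (x t) - b) =O[atTop] Ψ := by
    refine IsBigO.of_bound (‖A‖ * √K + c * N) (key.mono fun t ht => ?_)
    rw [Real.norm_of_nonneg ht.1]
    exact ht.2.1
  refine ⟨?_, hO1.norm_left, hO2.norm_left, ?_⟩
  · have h1 : (fun t => ⟪ls, A (x t) - b⟫) =O[atTop] Ψ := by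
      refine IsBigO.trans ?_ hO2
      exact IsBigO.of_bound ‖ls‖ (Eventually.of_forall fun t => norm_inner_le_norm _ _)
    refine (hO1.add h1).congr_left fun t => ?_
    rw [hL, hL, hfeas, sub_self, inner_zero_right]
    ring
  · refine IsBigO.of_bound K (key.mono fun t ht => ?_)
    rw [Real.norm_of_nonneg (by positivity), Real.norm_of_nonneg ht.2.2.2.2]
    exact ht.2.2.2.1
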